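/- arXiv:2511.20838 — 2 statements merged into one kernel-verified Lean document; each statement's English description precedes it below -/
import Mathlib

section
/- Let n, m be positive integers, let σ = co{x₀,…,xₙ} ⊂ ℝⁿ be an n-simplex, and let ζ : ℝⁿ → ℝ^m be twice continuously differentiable on a neighborhood of σ. For k = 1,…,m let μ_k ≥ 0 satisfy μ_k ≥ |∂²ζ⁽ᵏ⁾(x)/∂x⁽q⁾∂x⁽r⁾ evaluated at ξ| for all q, r ∈ {1,…,n} and ξ ∈ σ, and for j = 0,…,n define cⱼ = max_{ν∈{0,…,n}} ‖xⱼ − x_ν‖₂². Then for every x ∈ σ with barycentric coordinates λ₀,…,λₙ (λⱼ ≥ 0, Σⱼλⱼ = 1, x = Σⱼλⱼxⱼ), one has ‖ζ(x) − Σ_{j=0}^n λⱼ ζ(xⱼ)‖_∞ ≤ ½ n (max_{k∈{1,…,m}} μ_k) (Σ_{j=0}^n λⱼ cⱼ). -/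
open Matrix

/-- The Euclidean (2-)norm of a finitely indexed real vector. -/
noncomputable def norm2 {ι : Type*} [Fintype ι] (v : ι → ℝ) : ℝ :=
  Real.sqrt (∑ i, v i ^ 2)

theorem norm2_sq {ι : Type*} [Fintype ι] (v : ι → ℝ) : norm2 v ^ 2 = ∑ i, v i ^ 2 :=
  Real.sq_sqrt (Finset.sum_nonneg fun i _ => sq_nonneg (v i))

/-- Jensen's inequality for the squared Euclidean norm. -/
theorem norm2_sub_sum_sq_le {ι κ : Type*} [Fintype ι] [Fintype κ] (w : κ → ℝ)
    (hw0 : ∀ j, 0 ≤ w j) (hw1 : ∑ j, w j = 1) (p : κ → ι → ℝ) (a : ι → ℝ) :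
    norm2 (a - ∑ j, w j • p j) ^ 2 ≤ ∑ j, w j * norm2 (a - p j) ^ 2 := by
  simp only [norm2_sq, Finset.mul_sum]
  rw [Finset.sum_comm]
  refine Finset.sum_le_sum fun i _ => ?_
  have h := (even_two.convexOn_pow (𝕜 := ℝ)).map_sum_le (t := Finset.univ) (w := w)
    (p := fun j => a i - p j i) (fun j _ => hw0 j) hw1 (fun _ _ => Set.mem_univ _)
  simpa [mul_sub, Finset.sum_sub_distrib, ← Finset.sum_mul, hw1] using h

/-- A map on `[0, 1]` whose second derivative is bounded by `C` differs from its linearization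
at `0` by at most `C / 2` at `1`. -/
theorem abs_sub_sub_deriv_le_of_abs_second_deriv_le {g g' g'' : ℝ → ℝ} {C : ℝ}
    (hg : ∀ t ∈ Set.Icc (0 : ℝ) 1, HasDerivAt g (g' t) t)
    (hg' : ∀ t ∈ Set.Icc (0 : ℝ) 1, HasDerivAt g' (g'' t) t)
    (hC : ∀ t ∈ Set.Icc (0 : ℝ) 1, |g'' t| ≤ C) :
    |g 1 - g 0 - g' 0| ≤ C / 2 := by
  have h0 : (0 : ℝ) ∈ Set.Icc (0 : ℝ) 1 := by simp
  have key : ∀ t ∈ Set.Icc (0 : ℝ) 1, |g' t - g' 0| ≤ C * t := fun t ht => by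
    have := (convex_Icc (0 : ℝ) 1).norm_image_sub_le_of_norm_hasDerivWithin_le
      (fun s hs => (hg' s hs).hasDerivWithinAt) hC h0 ht
    simpa [abs_of_nonneg ht.1] using this
  have hd : ∀ t ∈ Set.Icc (0 : ℝ) 1,
      HasDerivAt (fun s => g s - g 0 - s * g' 0) (g' t - g' 0) t := fun t ht => by
    simpa using ((hg t ht).sub_const (g 0)).fun_sub ((hasDerivAt_id' t).mul_const (g' 0))
  have hB : ∀ t, HasDerivAt (fun s : ℝ => C / 2 * s ^ 2) (C * t) t := fun t => by
    refine ((hasDerivAt_pow 2 t).const_mul (C / 2)).congr_deriv ?_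
    push_cast
    ring
  have := image_norm_le_of_norm_deriv_right_le_deriv_boundary
    (fun t ht => (hd t ht).continuousAt.continuousWithinAt)
    (fun t ht => (hd t (Set.Ico_subset_Icc_self ht)).hasDerivWithinAt)
    (by simp) hB (fun t ht => key t (Set.Ico_subset_Icc_self ht))
    (Set.right_mem_Icc.2 zero_le_one)
  simpa using this

theorem ContinuousLinearMap.apply_eq_sum_mul_single {ι : Type*} [Fintype ι] [DecidableEq ι]
    (L : (ι → ℝ) →L[ℝ] ℝ) (h : ι → ℝ) : L h = ∑ q, h q * L (Pi.single q 1) := by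
  conv_lhs => rw [← Finset.univ_sum_single h, map_sum]
  refine Finset.sum_congr rfl fun q _ => ?_
  rw [← smul_eq_mul, ← map_smul, ← Pi.single_smul, smul_eq_mul, mul_one]

theorem sum_sum_mul_le_card_mul_norm2_sq {ι : Type*} [Fintype ι] (h : ι → ℝ)
    (A : ι → ι → ℝ) {M : ℝ} (hM : 0 ≤ M) (hA : ∀ q r, |A q r| ≤ M) :
    |∑ q, h q * ∑ r, h r * A q r| ≤ Fintype.card ι * M * norm2 h ^ 2 := by
  calc |∑ q, h q * ∑ r, h r * A q r|
      ≤ ∑ q, |h q| * ∑ r, |h r| * M := by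
        refine (Finset.abs_sum_le_sum_abs _ _).trans (Finset.sum_le_sum fun q _ => ?_)
        rw [abs_mul]
        gcongr
        refine (Finset.abs_sum_le_sum_abs _ _).trans (Finset.sum_le_sum fun r _ => ?_)
        rw [abs_mul]
        gcongr
        exact hA q r
    _ = M * (∑ q, |h q|) ^ 2 := by rw [← Finset.sum_mul, ← Finset.sum_mul]; ring
    _ ≤ M * (Fintype.card ι * ∑ q, |h q| ^ 2) := by
        gcongr
        exact sq_sum_le_card_mul_sum_sq
    _ = Fintype.card ι * M * norm2 h ^ 2 := by simp only [sq_abs, norm2_sq]; ring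

/-- First-order Taylor estimate between two points of a convex set on which all second partial
derivatives are bounded by `M`. -/
theorem abs_sub_sub_fderiv_le_of_second_partials_le {ι : Type*} [Fintype ι] [DecidableEq ι]
    {f : (ι → ℝ) → ℝ} {U S : Set (ι → ℝ)} (hU : IsOpen U) (hSU : S ⊆ U) (hS : Convex ℝ S)
    (hf : ContDiffOn ℝ 2 f U) {M : ℝ} (hM0 : 0 ≤ M)
    (hM : ∀ q r, ∀ ξ ∈ S,
      |fderiv ℝ (fun y => fderiv ℝ f y (Pi.single q 1)) ξ (Pi.single r 1)| ≤ M)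
    {x y : ι → ℝ} (hx : x ∈ S) (hy : y ∈ S) :
    |f y - f x - fderiv ℝ f x (y - x)| ≤ 1 / 2 * Fintype.card ι * M * norm2 (y - x) ^ 2 := by
  set h := y - x with hh
  have hmem : ∀ t ∈ Set.Icc (0 : ℝ) 1, x + t • h ∈ S := fun t ht =>
    hS.add_smul_sub_mem hx hy ht
  have hline : ∀ t : ℝ, HasDerivAt (fun s : ℝ => x + s • h) h t := fun t => by
    simpa using ((hasDerivAt_id t).smul_const h).const_add x
  have hd1 : ∀ ξ ∈ S, DifferentiableAt ℝ f ξ := fun ξ hξ =>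
    (hf.contDiffAt (hU.mem_nhds (hSU hξ))).differentiableAt (by norm_num)
  have hd2 : ∀ ξ ∈ S, DifferentiableAt ℝ (fderiv ℝ f) ξ := fun ξ hξ =>
    ((hf.contDiffAt (hU.mem_nhds (hSU hξ))).fderiv_right (m := 1)
      (by norm_num)).differentiableAt (by norm_num)
  have hg' : ∀ t ∈ Set.Icc (0 : ℝ) 1,
      HasDerivAt (fun s => ∑ q, h q * fderiv ℝ f (x + s • h) (Pi.single q 1))
        (∑ q, h q * ∑ r, h r *
          fderiv ℝ (fun y => fderiv ℝ f y (Pi.single q 1)) (x + t • h) (Pi.single r 1)) t := by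
    intro t ht
    refine HasDerivAt.fun_sum fun q _ => HasDerivAt.const_mul _ ?_
    rw [← ContinuousLinearMap.apply_eq_sum_mul_single]
    have hp : DifferentiableAt ℝ (fun y => fderiv ℝ f y (Pi.single q 1)) (x + t • h) :=
      (hd2 _ (hmem t ht)).clm_apply (differentiableAt_const _)
    exact hp.hasFDerivAt.comp_hasDerivAt t (hline t)
  have hg : ∀ t ∈ Set.Icc (0 : ℝ) 1, HasDerivAt (fun s => f (x + s • h))
      (∑ q, h q * fderiv ℝ f (x + t • h) (Pi.single q 1)) t := by
    intro t ht
    rw [← ContinuousLinearMap.apply_eq_sum_mul_single]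
    exact (hd1 _ (hmem t ht)).hasFDerivAt.comp_hasDerivAt t (hline t)
  have := abs_sub_sub_deriv_le_of_abs_second_deriv_le hg hg' fun t ht =>
    sum_sum_mul_le_card_mul_norm2_sq h _ hM0 fun q r => hM q r _ (hmem t ht)
  simp only [← ContinuousLinearMap.apply_eq_sum_mul_single, one_smul, zero_smul, add_zero] at this
  rw [show x + h = y by simp [hh]] at this
  linarith

/-- the ∞-norm bound of Lemma 5, Appendix A of the paper: for a `C²`
map `ζ : ℝⁿ → ℝ^m` on a neighborhood of the simplex with second partial derivative
bounds `μₖ` and `cⱼ = max_ν ‖xⱼ − x_ν‖₂²`, for every `x` in the simplex with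
barycentric coordinates `λ`:
`‖ζ(x) − Σⱼ λⱼ ζ(xⱼ)‖_∞ ≤ ½ n (maxₖ μₖ)(Σⱼ λⱼ cⱼ)`. -/
theorem interpolation_error_sup_norm {n m : ℕ} (hn : 0 < n) (hm : 0 < m)
    (pts : Fin (n + 1) → (Fin n → ℝ))
    (hind : LinearIndependent ℝ (fun j : Fin n => pts j.succ - pts 0))
    (ζ : (Fin n → ℝ) → (Fin m → ℝ))
    (U : Set (Fin n → ℝ)) (hU : IsOpen U)
    (hσU : convexHull ℝ (Set.range pts) ⊆ U)
    (hζ : ContDiffOn ℝ 2 ζ U)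
    (μ : Fin m → ℝ) (hμ0 : ∀ k, 0 ≤ μ k)
    (hμ : ∀ (k : Fin m) (q r : Fin n), ∀ ξ ∈ convexHull ℝ (Set.range pts),
      |fderiv ℝ (fun y => fderiv ℝ (fun w => ζ w k) y (Pi.single q 1)) ξ
        (Pi.single r 1)| ≤ μ k)
    (lam : Fin (n + 1) → ℝ)
    (hlam0 : ∀ j, 0 ≤ lam j) (hlam1 : ∑ j, lam j = 1)
    (x : Fin n → ℝ) (hx : x = ∑ j, lam j • pts j) :
    ‖ζ x - ∑ j, lam j • ζ (pts j)‖ ≤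
      (1 / 2) * n *
        (Finset.univ.sup'
          (Finset.univ_nonempty_iff.mpr (Fin.pos_iff_nonempty.mp hm)) μ) *
        (∑ j, lam j *
          Finset.univ.sup' Finset.univ_nonempty
            (fun ν : Fin (n + 1) => norm2 (pts j - pts ν) ^ 2)) := by
  set c : Fin (n + 1) → ℝ := fun j => Finset.univ.sup' Finset.univ_nonempty
    (fun ν : Fin (n + 1) => norm2 (pts j - pts ν) ^ 2)
  set M := Finset.univ.sup'
    (Finset.univ_nonempty_iff.mpr (Fin.pos_iff_nonempty.mp hm)) μ
  have hμM : ∀ k, μ k ≤ M := fun k => Finset.le_sup' μ (Finset.mem_univ k)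
  have hM0 : 0 ≤ M := (hμ0 ⟨0, hm⟩).trans (hμM _)
  have hpts : ∀ j, pts j ∈ convexHull ℝ (Set.range pts) := fun j =>
    subset_convexHull ℝ _ (Set.mem_range_self j)
  have hxS : x ∈ convexHull ℝ (Set.range pts) := by
    rw [hx]
    exact (convex_convexHull ℝ _).sum_mem (fun j _ => hlam0 j) hlam1 fun j _ => hpts j
  have hdist : ∀ j, norm2 (pts j - x) ^ 2 ≤ c j := fun j => by
    rw [hx]
    refine (norm2_sub_sum_sq_le lam hlam0 hlam1 pts (pts j)).trans ?_
    calc ∑ ν, lam ν * norm2 (pts j - pts ν) ^ 2 ≤ ∑ ν, lam ν * c j :=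
          Finset.sum_le_sum fun ν _ => mul_le_mul_of_nonneg_left
            (Finset.le_sup' (fun ν => norm2 (pts j - pts ν) ^ 2) (Finset.mem_univ ν)) (hlam0 ν)
      _ = c j := by rw [← Finset.sum_mul, hlam1, one_mul]
  have hc0 : ∀ j, 0 ≤ c j := fun j => (sq_nonneg _).trans (hdist j)
  refine (pi_norm_le_iff_of_nonneg (mul_nonneg (by positivity)
    (Finset.sum_nonneg fun j _ => mul_nonneg (hlam0 j) (hc0 j)))).2 fun k => ?_
  have htaylor : ∀ j, |ζ (pts j) k - ζ x k - fderiv ℝ (fun w => ζ w k) x (pts j - x)| ≤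
      1 / 2 * n * M * c j := fun j => by
    have := abs_sub_sub_fderiv_le_of_second_partials_le hU hσU (convex_convexHull ℝ _)
      (contDiffOn_pi.1 hζ k) hM0 (fun q r ξ hξ => (hμ k q r ξ hξ).trans (hμM k)) hxS (hpts j)
    rw [Fintype.card_fin] at this
    exact this.trans (mul_le_mul_of_nonneg_left (hdist j) (by positivity))
  have hlin : ∑ j, lam j * fderiv ℝ (fun w => ζ w k) x (pts j - x) = 0 := by
    have hsum : ∑ j, lam j • (pts j - x) = 0 := by
      simp only [smul_sub, Finset.sum_sub_distrib, ← Finset.sum_smul, hlam1, one_smul, ← hx,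
        sub_self]
    simp only [← smul_eq_mul, ← map_smul, ← map_sum, hsum, map_zero]
  have hsplit : (ζ x - ∑ j, lam j • ζ (pts j)) k =
      -∑ j, lam j * (ζ (pts j) k - ζ x k - fderiv ℝ (fun w => ζ w k) x (pts j - x)) := by
    simp only [mul_sub (lam _), Finset.sum_sub_distrib, hlin, ← Finset.sum_mul, hlam1,
      Pi.sub_apply, Finset.sum_apply, Pi.smul_apply, smul_eq_mul]
    ring
  rw [hsplit, norm_neg, Finset.mul_sum]
  refine (norm_sum_le _ _).trans (Finset.sum_le_sum fun j _ => ?_)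
  rw [norm_mul, Real.norm_of_nonneg (hlam0 j), Real.norm_eq_abs]
  exact (mul_le_mul_of_nonneg_left (htaylor j) (hlam0 j)).trans_eq (by ring)
end

section
/- Let n be a positive integer, let σ = co{x₀,…,xₙ} ⊂ ℝⁿ be an n-simplex with Euclidean diameter at most t̄ (i.e., ‖xⱼ − x_k‖₂ ≤ t̄ for all j, k, and hence ‖xⱼ − x‖₂ ≤ t̄ for all x ∈ σ), and let φ : ℝⁿ → ℝ be twice continuously differentiable on a neighborhood of σ with |∂²φ(x)/∂x⁽q⁾∂x⁽r⁾ evaluated at ξ| ≤ A for all q, r ∈ {1,…,n} and all ξ ∈ σ. Let X ∈ ℝ^{n×n} be the matrix whose j-th row is (xⱼ − x₀)ᵀ and let φ̄ ∈ ℝⁿ be the vector whose j-th entry is φ(xⱼ) − φ(x₀) (j = 1,…,n). Then for every x ∈ σ: (i) ‖φ̄ − X∇φ(x)‖₂ ≤ A·n^{3/2}·t̄², and (ii) since X is invertible, ‖X⁻¹φ̄ − ∇φ(x)‖₂ ≤ ‖X⁻¹‖₂ · A·n^{3/2}·t̄², where ‖X⁻¹‖₂ is the spectral norm of X⁻¹.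 -/
open Matrix

/-- The matrix `X` whose `j`-th row is `(xⱼ − x₀)ᵀ`. -/
noncomputable def cpaX {n : ℕ} (pts : Fin (n + 1) → (Fin n → ℝ)) :
    Matrix (Fin n) (Fin n) ℝ :=
  Matrix.of fun j i => (pts j.succ - pts 0) i

theorem norm2_eq_norm_toLp {ι : Type*} [Fintype ι] (v : ι → ℝ) :
    norm2 v = ‖WithLp.toLp 2 v‖ := by
  simp [norm2, EuclideanSpace.norm_eq]

theorem norm2_nonneg {ι : Type*} [Fintype ι] (v : ι → ℝ) : 0 ≤ norm2 v :=
  Real.sqrt_nonneg _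

theorem norm2_sub_comm {ι : Type*} [Fintype ι] (v w : ι → ℝ) :
    norm2 (v - w) = norm2 (w - v) := by
  simp only [norm2_eq_norm_toLp, WithLp.toLp_sub]
  exact norm_sub_rev _ _

theorem convex_norm2_sub_le {ι : Type*} [Fintype ι] (p : ι → ℝ) (t : ℝ) :
    Convex ℝ {y : ι → ℝ | norm2 (y - p) ≤ t} := by
  have heq : {y : ι → ℝ | norm2 (y - p) ≤ t} =
      (WithLp.linearEquiv 2 ℝ (ι → ℝ)).symm.toLinearMap ⁻¹'
        Metric.closedBall (WithLp.toLp 2 p) t := by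
    ext y
    simp [norm2_eq_norm_toLp, dist_eq_norm]
  rw [heq]
  exact (convex_closedBall (WithLp.toLp 2 p) t).linear_preimage _

/-- A bound on pairwise Euclidean distances in a set passes to its convex hull. -/
theorem norm2_sub_le_of_mem_convexHull {ι : Type*} [Fintype ι] {s : Set (ι → ℝ)} {t : ℝ}
    (h : ∀ x ∈ s, ∀ y ∈ s, norm2 (x - y) ≤ t) {x y : ι → ℝ}
    (hx : x ∈ convexHull ℝ s) (hy : y ∈ convexHull ℝ s) : norm2 (x - y) ≤ t := by
  refine convexHull_min (fun a ha => ?_) (convex_norm2_sub_le y t) hx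
  change norm2 (a - y) ≤ t
  rw [norm2_sub_comm]
  exact convexHull_min (fun b hb => h b hb a ha) (convex_norm2_sub_le a t) hy

theorem sum_abs_le_sqrt_card_mul_norm2 {ι : Type*} [Fintype ι] (v : ι → ℝ) :
    ∑ i, |v i| ≤ √(Fintype.card ι) * norm2 v := by
  rw [norm2, ← Real.sqrt_mul (Nat.cast_nonneg _)]
  apply Real.le_sqrt_of_sq_le
  simpa using sq_sum_le_card_mul_sum_sq (s := Finset.univ) (f := fun i => |v i|)

theorem norm2_le_sqrt_card_mul {ι : Type*} [Fintype ι] {v : ι → ℝ} {b : ℝ}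
    (hb : 0 ≤ b) (h : ∀ i, |v i| ≤ b) : norm2 v ≤ √(Fintype.card ι) * b := by
  rw [norm2, Real.sqrt_le_left (by positivity), mul_pow, Real.sq_sqrt (Nat.cast_nonneg _)]
  calc ∑ i, v i ^ 2 ≤ ∑ _i : ι, b ^ 2 :=
        Finset.sum_le_sum fun i _ => sq_le_sq' (abs_le.1 (h i)).1 (abs_le.1 (h i)).2
    _ = Fintype.card ι * b ^ 2 := by simp

theorem ContinuousLinearMap.apply_eq_sum_single {ι : Type*} [Fintype ι] [DecidableEq ι]
    (L : (ι → ℝ) →L[ℝ] ℝ) (v : ι → ℝ) : L v = ∑ i, v i * L (Pi.single i 1) := by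
  conv_lhs => rw [pi_eq_sum_univ' v]
  simp [map_sum]

/-- If all second partial derivatives of `φ` are bounded by `A` on a convex set, then so is the
variation of its directional derivatives, with the factor `A ‖w‖₁ ‖y - x‖₁`. -/
theorem abs_fderiv_apply_sub_le {ι : Type*} [Fintype ι] [DecidableEq ι]
    {φ : (ι → ℝ) → ℝ} {U s : Set (ι → ℝ)} (hU : IsOpen U) (hsU : s ⊆ U) (hs : Convex ℝ s)
    (hφ : ContDiffOn ℝ 2 φ U) {A : ℝ}
    (hA : ∀ q r : ι, ∀ ξ ∈ s,
      |fderiv ℝ (fun y => fderiv ℝ φ y (Pi.single q 1)) ξ (Pi.single r 1)| ≤ A)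
    {x y : ι → ℝ} (hx : x ∈ s) (hy : y ∈ s) (w : ι → ℝ) :
    |fderiv ℝ φ y w - fderiv ℝ φ x w| ≤ A * (∑ i, |w i|) * ∑ i, |(y - x) i| := by
  have hd : DifferentiableOn ℝ (fderiv ℝ φ) U :=
    (hφ.fderiv_of_isOpen hU (m := 1) (by norm_num)).differentiableOn (by norm_num)
  have hdiff : ∀ ξ ∈ s, ∀ q : ι,
      DifferentiableAt ℝ (fun y => fderiv ℝ φ y (Pi.single q 1)) ξ := fun ξ hξ q =>
    (hd.differentiableAt (hU.mem_nhds (hsU hξ))).clm_apply (differentiableAt_const _)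
  have hderiv : ∀ ξ ∈ s, HasFDerivWithinAt (fun y => fderiv ℝ φ y w)
      (∑ q, w q • fderiv ℝ (fun y => fderiv ℝ φ y (Pi.single q 1)) ξ) s ξ := fun ξ hξ => by
    have heq : (fun y => fderiv ℝ φ y w) =
        fun y => ∑ q, w q * fderiv ℝ φ y (Pi.single q 1) :=
      funext fun y => (fderiv ℝ φ y).apply_eq_sum_single w
    rw [heq]
    exact (HasFDerivAt.fun_sum fun q _ =>
      (hdiff ξ hξ q).hasFDerivAt.const_mul (w q)).hasFDerivWithinAt
  obtain ⟨ξ, hξ, h⟩ := domain_mvt hderiv hs hx hy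
  replace hξ := hs.segment_subset hx hy hξ
  rw [h, _root_.sum_apply, mul_assoc, Finset.sum_mul, Finset.mul_sum]
  refine (Finset.abs_sum_le_sum_abs _ _).trans (Finset.sum_le_sum fun q _ => ?_)
  rw [_root_.smul_apply, smul_eq_mul, abs_mul, mul_left_comm]
  refine mul_le_mul_of_nonneg_left ?_ (abs_nonneg _)
  rw [ContinuousLinearMap.apply_eq_sum_single, Finset.mul_sum]
  refine (Finset.abs_sum_le_sum_abs _ _).trans (Finset.sum_le_sum fun r _ => ?_)
  rw [abs_mul, mul_comm]
  exact mul_le_mul_of_nonneg_right (hA q r ξ hξ) (abs_nonneg _)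

/-- the gradient-approximation bound from the proof of Theorem 8 of
the paper: for a `C²` function `φ` on a neighborhood of a simplex with Euclidean
diameter at most `t̄` and second partial derivatives bounded by `A`, with `X` the
vertex-difference matrix and `φ̄` the vertex-value-difference vector:
(i) `‖φ̄ − X∇φ(x)‖₂ ≤ A n^{3/2} t̄²` for every `x` in the simplex; and
(ii) `X` is invertible and `‖X⁻¹φ̄ − ∇φ(x)‖₂ ≤ ‖X⁻¹‖₂ A n^{3/2} t̄²`, where
the spectral-norm bound `‖X⁻¹‖₂ ≤ c` is expressed vectorwise. -/
theorem cpa_gradient_approximation {n : ℕ} (hn : 0 < n)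
    (pts : Fin (n + 1) → (Fin n → ℝ))
    (hind : LinearIndependent ℝ (fun j : Fin n => pts j.succ - pts 0))
    (tbar : ℝ)
    (htbar : ∀ j k : Fin (n + 1), norm2 (pts j - pts k) ≤ tbar)
    (φ : (Fin n → ℝ) → ℝ)
    (U : Set (Fin n → ℝ)) (hU : IsOpen U)
    (hσU : convexHull ℝ (Set.range pts) ⊆ U)
    (hφ : ContDiffOn ℝ 2 φ U)
    (A : ℝ) (hA0 : 0 ≤ A)
    (hA : ∀ q r : Fin n, ∀ ξ ∈ convexHull ℝ (Set.range pts),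
      |fderiv ℝ (fun y => fderiv ℝ φ y (Pi.single q 1)) ξ (Pi.single r 1)| ≤ A) :
    (∀ x ∈ convexHull ℝ (Set.range pts),
      norm2 ((fun j : Fin n => φ (pts j.succ) - φ (pts 0)) -
          (cpaX pts) *ᵥ (fun i => fderiv ℝ φ x (Pi.single i 1))) ≤
        A * (n : ℝ) ^ ((3 : ℝ) / 2) * tbar ^ 2) ∧
    IsUnit (cpaX pts).det ∧
    (∀ x ∈ convexHull ℝ (Set.range pts), ∀ c : ℝ,
      (∀ v : Fin n → ℝ, norm2 ((cpaX pts)⁻¹ *ᵥ v) ≤ c * norm2 v) →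
      norm2 ((cpaX pts)⁻¹ *ᵥ (fun j : Fin n => φ (pts j.succ) - φ (pts 0)) -
          (fun i => fderiv ℝ φ x (Pi.single i 1))) ≤
        c * (A * (n : ℝ) ^ ((3 : ℝ) / 2) * tbar ^ 2)) := by
  have hconv := convex_convexHull ℝ (Set.range pts)
  have hmem : ∀ j, pts j ∈ convexHull ℝ (Set.range pts) := fun j =>
    subset_convexHull ℝ _ (Set.mem_range_self j)
  have hdiam : ∀ x ∈ convexHull ℝ (Set.range pts), ∀ y ∈ convexHull ℝ (Set.range pts),
      norm2 (x - y) ≤ tbar := fun x hx y hy =>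
    norm2_sub_le_of_mem_convexHull
      (Set.forall_mem_range.2 fun j => Set.forall_mem_range.2 (htbar j)) hx hy
  have ht : 0 ≤ tbar := (norm2_nonneg _).trans (htbar 0 0)
  have hl1 : ∀ x ∈ convexHull ℝ (Set.range pts), ∀ y ∈ convexHull ℝ (Set.range pts),
      ∑ i, |(x - y) i| ≤ √n * tbar := fun x hx y hy => by
    have h := sum_abs_le_sqrt_card_mul_norm2 (x - y)
    rw [Fintype.card_fin] at h
    exact h.trans (mul_le_mul_of_nonneg_left (hdiam x hx y hy) (Real.sqrt_nonneg _))
  have hsq : √(n : ℝ) * √n = n := Real.mul_self_sqrt (Nat.cast_nonneg n)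
  have hpow : (n : ℝ) ^ ((3 : ℝ) / 2) = √n * n := by
    rw [show (3 : ℝ) / 2 = 1 / 2 + 1 by norm_num, Real.rpow_add (by exact_mod_cast hn),
      Real.rpow_one, Real.sqrt_eq_rpow]
  have hbound : ∀ x ∈ convexHull ℝ (Set.range pts),
      norm2 ((fun j : Fin n => φ (pts j.succ) - φ (pts 0)) -
          (cpaX pts) *ᵥ (fun i => fderiv ℝ φ x (Pi.single i 1))) ≤
        A * (n : ℝ) ^ ((3 : ℝ) / 2) * tbar ^ 2 := by
    intro x hx
    have hcomp : ∀ j : Fin n, |((fun j : Fin n => φ (pts j.succ) - φ (pts 0)) -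
        (cpaX pts) *ᵥ (fun i => fderiv ℝ φ x (Pi.single i 1))) j| ≤ A * n * tbar ^ 2 := by
      intro j
      obtain ⟨z, hz, h⟩ := domain_mvt (f := φ) (f' := fderiv ℝ φ)
        (fun y hy => ((hφ.differentiableOn (by norm_num)).differentiableAt
          (hU.mem_nhds (hσU hy))).hasFDerivAt.hasFDerivWithinAt) hconv (hmem 0) (hmem j.succ)
      replace hz := hconv.segment_subset (hmem 0) (hmem j.succ) hz
      have hX : ((cpaX pts) *ᵥ (fun i => fderiv ℝ φ x (Pi.single i 1))) j =
          fderiv ℝ φ x (pts j.succ - pts 0) :=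
        ((fderiv ℝ φ x).apply_eq_sum_single _).symm
      rw [Pi.sub_apply, hX, h]
      calc _ ≤ A * (∑ i, |(pts j.succ - pts 0) i|) * ∑ i, |(z - x) i| :=
            abs_fderiv_apply_sub_le hU hσU hconv hφ hA hx hz _
        _ ≤ A * (√n * tbar) * (√n * tbar) := by
            gcongr
            · exact hl1 _ (hmem _) _ (hmem _)
            · exact hl1 _ hz _ hx
        _ = A * (√n * √n) * tbar ^ 2 := by ring
        _ = A * n * tbar ^ 2 := by rw [hsq]
    refine (norm2_le_sqrt_card_mul (by positivity) hcomp).trans_eq ?_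
    rw [Fintype.card_fin, hpow]
    ring
  have hdet : IsUnit (cpaX pts).det :=
    (Matrix.isUnit_iff_isUnit_det _).1 (Matrix.linearIndependent_rows_iff_isUnit.1 hind)
  refine ⟨hbound, hdet, fun x hx c hc => ?_⟩
  have hc0 : 0 ≤ c := by
    have h := (norm2_nonneg _).trans (hc (Pi.single ⟨0, hn⟩ 1))
    have hone : norm2 (Pi.single ⟨0, hn⟩ 1 : Fin n → ℝ) = 1 := by
      rw [norm2_eq_norm_toLp, PiLp.toLp_single]
      simp
    rwa [hone, mul_one] at h
  have hinv : (cpaX pts)⁻¹ *ᵥ (fun j : Fin n => φ (pts j.succ) - φ (pts 0)) -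
      (fun i => fderiv ℝ φ x (Pi.single i 1)) =
      (cpaX pts)⁻¹ *ᵥ ((fun j : Fin n => φ (pts j.succ) - φ (pts 0)) -
        (cpaX pts) *ᵥ (fun i => fderiv ℝ φ x (Pi.single i 1))) := by
    rw [Matrix.mulVec_sub, Matrix.mulVec_mulVec, Matrix.nonsing_inv_mul _ hdet,
      Matrix.one_mulVec]
  rw [hinv]
  exact (hc _).trans (mul_le_mul_of_nonneg_left (hbound x hx) hc0)
end
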